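/- arXiv:0904.4600 — 4 statements merged into one kernel-verified Lean document; each statement's English description precedes it below -/
import Mathlib

section
/- For every integer k ≥ 1, s(K_2, K_{4k/(2k−1)}) = 2k/(2k+1). -/
open scoped Classical

noncomputable section

/-- The circular complete graph `K_{p/q}`: vertices `v_0, …, v_{p-1}` with an edge
`v_i v_j` whenever `q ≤ |i - j| ≤ p - q`. -/
def circK (p q : ℕ) : SimpleGraph (Fin p) :=
  SimpleGraph.fromRel (fun i j =>
    q ≤ max i.val j.val - min i.val j.val ∧ max i.val j.val - min i.val j.val ≤ p - q)

/-- The complete graph on two vertices. -/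
def K2 : SimpleGraph (Fin 2) := ⊤

/-- The cycle graph on `n` vertices. -/
def cycleG (n : ℕ) : SimpleGraph (Fin n) :=
  SimpleGraph.fromRel (fun i j => (i.val + 1) % n = j.val)

/-- The total weight of the edges of `G` carried to edges of `H` by the vertex map `f`. -/
def cutWeight {α β : Type} [Fintype α] (G : SimpleGraph α) (H : SimpleGraph β)
    (w : Sym2 α → ℚ) (f : α → β) : ℝ :=
  ∑ e ∈ Finset.univ.filter (fun e : Sym2 α => e ∈ G.edgeSet ∧ Sym2.map f e ∈ H.edgeSet), (w e : ℝ)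

/-- `mc_H(G,w)`: the maximum over all vertex maps `f : V(G) → V(H)` of the total weight
of the edges of `G` mapped to edges of `H`. -/
def mcMax {α β : Type} [Fintype α] (H : SimpleGraph β) (G : SimpleGraph α)
    (w : Sym2 α → ℚ) : ℝ :=
  ⨆ f : α → β, cutWeight G H w f

/-- `s(M,N)`: the infimum over all finite simple graphs `G` with at least one edge and all
positive rational edge-weight functions `w` of `mc_M(G,w)/mc_N(G,w)`. -/
def sVal {α β : Type} (M : SimpleGraph α) (N : SimpleGraph β) : ℝ :=
  sInf { x : ℝ | ∃ (n : ℕ) (G : SimpleGraph (Fin n)) (w : Sym2 (Fin n) → ℚ),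
    G.edgeSet.Nonempty ∧ (∀ e ∈ G.edgeSet, 0 < w e) ∧
    x = mcMax M G w / mcMax N G w }

lemma circ_adj (k : ℕ) (x y : Fin (4*k)) : (circK (4*k) (2*k-1)).Adj x y ↔ x ≠ y ∧
    (2*k-1 ≤ max x.val y.val - min x.val y.val ∧
      max x.val y.val - min x.val y.val ≤ 4*k - (2*k-1)) := by
  unfold circK
  rw [SimpleGraph.fromRel_adj, max_comm y.val x.val, min_comm y.val x.val, or_self]

/-- the cuts of the circular graph -/
def cc (k j : ℕ) (x : Fin (4*k)) : Fin 2 :=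
  if (if j = 2*k then x.val % 2 = 0 else (j ≤ x.val ∧ x.val < j + 2*k)) then 0 else 1

lemma cc_adj (k j : ℕ) (x y : Fin (4*k)) : K2.Adj (cc k j x) (cc k j y) ↔
   ¬ ((if j = 2*k then x.val % 2 = 0 else (j ≤ x.val ∧ x.val < j + 2*k)) ↔
    (if j = 2*k then y.val % 2 = 0 else (j ≤ y.val ∧ y.val < j + 2*k))) := by
  unfold K2 cc
  rw [SimpleGraph.top_adj]
  by_cases h1 : (if j = 2*k then x.val % 2 = 0 else (j ≤ x.val ∧ x.val < j + 2*k)) <;>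
  by_cases h2 : (if j = 2*k then y.val % 2 = 0 else (j ≤ y.val ∧ y.val < j + 2*k)) <;>
  simp only [h1, h2] <;> simp

lemma cc_lt (k : ℕ) (hk : 1 ≤ k) (x y : Fin (4*k)) (hxy : x.val < y.val)
    (h : (circK (4*k) (2*k-1)).Adj x y) :
    ∃ j0, ∀ j ∈ Finset.range (2*k+1), j ≠ j0 → K2.Adj (cc k j x) (cc k j y) := by
  rw [circ_adj] at h
  obtain ⟨-, h1, h2⟩ := h
  rw [max_eq_right hxy.le, min_eq_left hxy.le] at h1 h2
  have hy := y.2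
  refine ⟨if y.val - x.val = 2*k then 2*k else if y.val - x.val = 2*k-1 then
    (if x.val = 2*k then 0 else x.val) else x.val + 1, ?_⟩
  intro j hj hne
  rw [Finset.mem_range] at hj
  rw [cc_adj]
  generalize x.val = a at *
  generalize y.val = b at *
  split_ifs at hne ⊢ <;> omega

lemma cc_edge (k : ℕ) (hk : 1 ≤ k) (e : Sym2 (Fin (4*k)))
    (h : e ∈ (circK (4*k) (2*k-1)).edgeSet) :
    ∃ j0, ∀ j ∈ Finset.range (2*k+1), j ≠ j0 → Sym2.map (cc k j) e ∈ K2.edgeSet := by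
  induction e with
  | h x y =>
    simp only [Sym2.map_mk, SimpleGraph.mem_edgeSet] at h ⊢
    rcases lt_trichotomy x.val y.val with hl | hl | hl
    · exact cc_lt k hk x y hl h
    · exact absurd (Fin.ext hl) h.ne
    · obtain ⟨j0, hj⟩ := cc_lt k hk y x hl h.symm
      exact ⟨j0, fun j h1 h2 => (hj j h1 h2).symm⟩

lemma cw_le_mc {α β : Type} [Fintype α] [Finite β] (G : SimpleGraph α) (H : SimpleGraph β)
    (w : Sym2 α → ℚ) (f : α → β) : cutWeight G H w f ≤ mcMax H G w := by
  unfold mcMax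
  exact le_ciSup (Set.finite_range _).bddAbove f

lemma lower (k : ℕ) (hk : 1 ≤ k) {n : ℕ} (G : SimpleGraph (Fin n)) (w : Sym2 (Fin n) → ℚ)
    (hw : ∀ e ∈ G.edgeSet, 0 < w e) (f : Fin n → Fin (4*k)) :
    2*(k:ℝ) * cutWeight G (circK (4*k) (2*k-1)) w f ≤ (2*(k:ℝ)+1) * mcMax K2 G w := by
  have h1 : ∑ j ∈ Finset.range (2*k+1), cutWeight G K2 w (cc k j ∘ f) ≤
      (2*(k:ℝ)+1) * mcMax K2 G w := by
    refine (Finset.sum_le_card_nsmul _ _ (mcMax K2 G w) (fun j _ => cw_le_mc _ _ _ _)).trans ?_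
    rw [Finset.card_range, nsmul_eq_mul]
    push_cast
    exact le_rfl
  refine le_trans ?_ h1
  unfold cutWeight
  simp only [Finset.sum_filter]
  rw [Finset.sum_comm, Finset.mul_sum]
  refine Finset.sum_le_sum fun e _ => ?_
  by_cases hG : e ∈ G.edgeSet
  swap
  · simp [hG]
  have hp : (0:ℝ) < w e := by exact_mod_cast hw e hG
  by_cases hN : Sym2.map f e ∈ (circK (4*k) (2*k-1)).edgeSet
  swap
  · rw [if_neg (fun h => hN h.2), mul_zero]
    refine Finset.sum_nonneg fun j _ => ?_
    split_ifs
    · exact hp.le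
    · exact le_rfl
  rw [if_pos ⟨hG, hN⟩]
  obtain ⟨j0, hj⟩ := cc_edge k hk _ hN
  have h2 : ∑ j ∈ (Finset.range (2*k+1)).erase j0, (w e : ℝ) ≤
      ∑ j ∈ Finset.range (2*k+1),
        (if e ∈ G.edgeSet ∧ Sym2.map (cc k j ∘ f) e ∈ K2.edgeSet then (w e : ℝ) else 0) := by
    refine le_trans (Finset.sum_le_sum ?_) (Finset.sum_le_sum_of_subset_of_nonneg
      (Finset.erase_subset j0 _) ?_)
    · intro j hjm
      rw [Finset.mem_erase] at hjm
      have := hj j hjm.2 hjm.1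
      rw [Sym2.map_map] at this
      rw [if_pos ⟨hG, this⟩]
    · intro j _ _
      split_ifs
      · exact hp.le
      · exact le_rfl
  refine le_trans ?_ h2
  rw [Finset.sum_const, nsmul_eq_mul]
  have h3 : 2*k ≤ ((Finset.range (2*k+1)).erase j0).card := by
    have := Finset.pred_card_le_card_erase (s := Finset.range (2*k+1)) (a := j0)
    rw [Finset.card_range] at this
    omega
  have h4 : (2*(k:ℝ)) ≤ (((Finset.range (2*k+1)).erase j0).card : ℝ) := by exact_mod_cast h3
  exact mul_le_mul_of_nonneg_right h4 hp.le

lemma mcN_pos (k : ℕ) (hk : 1 ≤ k) {n : ℕ} (G : SimpleGraph (Fin n)) (w : Sym2 (Fin n) → ℚ)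
    (hne : G.edgeSet.Nonempty) (hw : ∀ e ∈ G.edgeSet, 0 < w e) :
    0 < mcMax (circK (4*k) (2*k-1)) G w := by
  obtain ⟨e, he⟩ := hne
  induction e with
  | h u v =>
    have huv : u ≠ v := G.ne_of_adj he
    let f : Fin n → Fin (4*k) := fun x => if x = u then ⟨0, by omega⟩ else ⟨2*k, by omega⟩
    refine lt_of_lt_of_le ?_ (cw_le_mc G (circK (4*k) (2*k-1)) w f)
    unfold cutWeight
    refine Finset.sum_pos ?_ ⟨s(u,v), ?_⟩
    · intro e he
      rw [Finset.mem_filter] at he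
      exact_mod_cast hw e he.2.1
    · rw [Finset.mem_filter]
      refine ⟨Finset.mem_univ _, he, ?_⟩
      rw [Sym2.map_mk, SimpleGraph.mem_edgeSet, circ_adj]
      simp only [f, if_pos, if_neg huv.symm, ne_eq, Fin.mk.injEq]
      omega

lemma cyc_edge (n : ℕ) (hn : 2 ≤ n) (i : Fin n) :
    (cycleG n).Adj i ⟨(i.val+1) % n, Nat.mod_lt _ (by omega)⟩ := by
  unfold cycleG
  rw [SimpleGraph.fromRel_adj]
  refine ⟨fun h => ?_, Or.inl rfl⟩
  have h' := congrArg Fin.val h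
  simp only at h'
  have hi := i.2
  rcases Nat.lt_or_ge (i.val+1) n with h1 | h1
  · rw [Nat.mod_eq_of_lt h1] at h'
    omega
  · have : i.val + 1 = n := by omega
    rw [this, Nat.mod_self] at h'
    omega

lemma cyc_cut (k : ℕ) (f : Fin (2*k+1) → Fin 2) :
    ∃ i : Fin (2*k+1), f i = f ⟨(i.val+1) % (2*k+1), Nat.mod_lt _ (by omega)⟩ := by
  by_contra! hc
  have key : ∀ i (hi : i < 2*k+1), (f ⟨i, hi⟩).val = ((f ⟨0, by omega⟩).val + i) % 2 := by
    intro i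
    induction i with
    | zero => intro hi; have := (f ⟨0, hi⟩).2; omega
    | succ i ih =>
      intro hi
      have h1 := ih (by omega)
      have h2 := hc ⟨i, by omega⟩
      simp only [Nat.mod_eq_of_lt hi] at h2
      have h3 : (f ⟨i, by omega⟩).val ≠ (f ⟨i+1, hi⟩).val := fun h => h2 (Fin.ext h)
      have := (f ⟨i+1, hi⟩).2
      omega
  have h1 := key (2*k) (by omega)
  have h2 := hc ⟨2*k, by omega⟩
  simp only [Nat.mod_self] at h2
  apply h2
  apply Fin.ext
  rw [h1]
  have := (f ⟨0, by omega⟩).2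
  omega

lemma cyc_card (n : ℕ) (hn : 1 ≤ n) :
    (Finset.univ.filter (fun e : Sym2 (Fin n) => e ∈ (cycleG n).edgeSet)).card ≤ n := by
  have : Finset.univ.filter (fun e : Sym2 (Fin n) => e ∈ (cycleG n).edgeSet) ⊆
      Finset.univ.image (fun i : Fin n => s(i, ⟨(i.val+1) % n, Nat.mod_lt _ (by omega)⟩)) := by
    intro e he
    rw [Finset.mem_filter] at he
    have he := he.2
    rw [Finset.mem_image]
    induction e with
    | h u v =>
      unfold cycleG at he
      rw [SimpleGraph.mem_edgeSet, SimpleGraph.fromRel_adj] at he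
      rcases he.2 with h | h
      · refine ⟨u, Finset.mem_univ _, ?_⟩
        simp only [h]
      · refine ⟨v, Finset.mem_univ _, ?_⟩
        simp only [h]
        exact Sym2.eq_swap
  refine (Finset.card_le_card this).trans (Finset.card_image_le.trans ?_)
  simp

lemma walk_adj (k : ℕ) (hk : 1 ≤ k) (u v : Fin (2*k+1)) (h : (u.val+1) % (2*k+1) = v.val) :
    (circK (4*k) (2*k-1)).Adj (⟨((2*k-1)*u.val) % (4*k), Nat.mod_lt _ (by omega)⟩ : Fin (4*k))
      ⟨((2*k-1)*v.val) % (4*k), Nat.mod_lt _ (by omega)⟩ := by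
  rw [circ_adj]
  have hu := u.2
  simp only [ne_eq, Fin.mk.injEq]
  rcases Nat.lt_or_ge (u.val+1) (2*k+1) with h1 | h1
  · rw [Nat.mod_eq_of_lt h1] at h
    rw [← h]
    have e : (2*k-1)*(u.val+1) = (2*k-1)*u.val + (2*k-1) := by ring
    rw [e]
    generalize (2*k-1)*u.val = a
    have hb := Nat.mod_lt a (show 0 < 4*k by omega)
    rw [Nat.add_mod a, Nat.mod_eq_of_lt (show 2*k-1 < 4*k by omega)]
    generalize a % (4*k) = b at *
    rcases Nat.lt_or_ge (b + (2*k-1)) (4*k) with h2 | h2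
    · rw [Nat.mod_eq_of_lt h2]
      omega
    · rw [Nat.mod_eq_sub_mod h2, Nat.mod_eq_of_lt (by omega)]
      omega
  · have h2 : u.val = 2*k := by omega
    rw [h2, Nat.mod_self] at h
    rw [h2, ← h]
    have e : (2*k-1)*(2*k) = 2*k + (4*k)*(k-1) := by
      obtain ⟨m, rfl⟩ : ∃ m, k = m+1 := ⟨k-1, by omega⟩
      have : 2*(m+1)-1 = 2*m+1 := by omega
      rw [this, Nat.add_sub_cancel]
      ring
    rw [e, Nat.add_mul_mod_self_left, Nat.mod_eq_of_lt (by omega : 2*k < 4*k)]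
    simp only [mul_zero, Nat.zero_mod]
    omega

lemma upper (k : ℕ) (hk : 1 ≤ k) :
    mcMax K2 (cycleG (2*k+1)) (fun _ => 1) /
      mcMax (circK (4*k) (2*k-1)) (cycleG (2*k+1)) (fun _ => 1) ≤ (2*(k:ℝ)) / (2*(k:ℝ)+1) := by
  set E := Finset.univ.filter (fun e : Sym2 (Fin (2*k+1)) => e ∈ (cycleG (2*k+1)).edgeSet) with hE
  have hc : E.card ≤ 2*k+1 := cyc_card _ (by omega)
  have hpos : 0 < E.card := by
    refine Finset.card_pos.mpr ⟨s((⟨0, by omega⟩ : Fin (2*k+1)),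
      ⟨(0+1) % (2*k+1), Nat.mod_lt _ (by omega)⟩), ?_⟩
    rw [hE, Finset.mem_filter]
    exact ⟨Finset.mem_univ _, cyc_edge (2*k+1) (by omega) ⟨0, by omega⟩⟩
  have hN : (E.card : ℝ) ≤ mcMax (circK (4*k) (2*k-1)) (cycleG (2*k+1)) (fun _ => 1) := by
    refine le_trans (le_of_eq ?_) (cw_le_mc _ _ _ (fun u : Fin (2*k+1) =>
      (⟨((2*k-1)*u.val) % (4*k), Nat.mod_lt _ (by omega)⟩ : Fin (4*k))))
    unfold cutWeight
    rw [Finset.sum_const, nsmul_eq_mul, Rat.cast_one, mul_one, hE]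
    congr 2
    ext e
    simp only [Finset.mem_filter, Finset.mem_univ, true_and]
    refine ⟨fun h => ⟨h, ?_⟩, fun h => h.1⟩
    induction e with
    | h u v =>
      rw [SimpleGraph.mem_edgeSet] at h
      unfold cycleG at h
      rw [SimpleGraph.fromRel_adj] at h
      rw [Sym2.map_mk, SimpleGraph.mem_edgeSet]
      rcases h.2 with h | h
      · exact walk_adj k hk u v h
      · exact (walk_adj k hk v u h).symm
  have hM : mcMax K2 (cycleG (2*k+1)) (fun _ => 1) ≤ (E.card : ℝ) - 1 := by
    unfold mcMax
    refine ciSup_le fun f => ?_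
    unfold cutWeight
    rw [Finset.sum_const, nsmul_eq_mul, Rat.cast_one, mul_one]
    obtain ⟨i, hi⟩ := cyc_cut k f
    have : (Finset.univ.filter (fun e : Sym2 (Fin (2*k+1)) => e ∈ (cycleG (2*k+1)).edgeSet ∧
        Sym2.map f e ∈ K2.edgeSet)).card < E.card := by
      apply Finset.card_lt_card
      rw [Finset.ssubset_iff_of_subset]
      · refine ⟨s(i, ⟨(i.val+1) % (2*k+1), Nat.mod_lt _ (by omega)⟩), ?_, ?_⟩
        · rw [hE, Finset.mem_filter]
          exact ⟨Finset.mem_univ _, cyc_edge (2*k+1) (by omega) i⟩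
        · rw [Finset.mem_filter]
          rintro ⟨-, -, h⟩
          rw [Sym2.map_mk, SimpleGraph.mem_edgeSet] at h
          exact h.ne hi
      · intro e he
        rw [Finset.mem_filter] at he
        rw [hE, Finset.mem_filter]
        exact ⟨he.1, he.2.1⟩
    have h2 : ((Finset.univ.filter (fun e : Sym2 (Fin (2*k+1)) => e ∈ (cycleG (2*k+1)).edgeSet ∧
        Sym2.map f e ∈ K2.edgeSet)).card : ℝ) + 1 ≤ E.card := by exact_mod_cast this
    linarith
  have hc' : (E.card : ℝ) ≤ 2*k+1 := by exact_mod_cast hc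
  have hpos' : (0:ℝ) < E.card := by exact_mod_cast hpos
  have hk' : (0:ℝ) ≤ k := Nat.cast_nonneg k
  rw [div_le_div_iff₀ (by linarith) (by linarith)]
  nlinarith

theorem stmt0 (k : ℕ) (hk : 1 ≤ k) :
    sVal K2 (circK (4*k) (2*k-1)) = (2*(k:ℝ)) / (2*(k:ℝ)+1) := by
  have hk' : (0:ℝ) ≤ k := Nat.cast_nonneg k
  have hlow : ∀ x ∈ { x : ℝ | ∃ (n : ℕ) (G : SimpleGraph (Fin n)) (w : Sym2 (Fin n) → ℚ),
    G.edgeSet.Nonempty ∧ (∀ e ∈ G.edgeSet, 0 < w e) ∧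
    x = mcMax K2 G w / mcMax (circK (4*k) (2*k-1)) G w }, (2*(k:ℝ)) / (2*(k:ℝ)+1) ≤ x := by
    rintro x ⟨n, G, w, hne, hw, rfl⟩
    have hp := mcN_pos k hk G w hne hw
    have : Nonempty (Fin (4*k)) := ⟨⟨0, by omega⟩⟩
    obtain ⟨f, hf⟩ := exists_eq_ciSup_of_finite
      (f := fun f : Fin n → Fin (4*k) => cutWeight G (circK (4*k) (2*k-1)) w f)
    have h := lower k hk G w hw f
    have hf' : cutWeight G (circK (4*k) (2*k-1)) w f = mcMax (circK (4*k) (2*k-1)) G w := hf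
    rw [hf'] at h
    rw [div_le_div_iff₀ (by linarith) hp]
    linarith
  have hmem : mcMax K2 (cycleG (2*k+1)) (fun _ => 1) /
      mcMax (circK (4*k) (2*k-1)) (cycleG (2*k+1)) (fun _ => 1) ∈
      { x : ℝ | ∃ (n : ℕ) (G : SimpleGraph (Fin n)) (w : Sym2 (Fin n) → ℚ),
    G.edgeSet.Nonempty ∧ (∀ e ∈ G.edgeSet, 0 < w e) ∧
    x = mcMax K2 G w / mcMax (circK (4*k) (2*k-1)) G w } :=
    ⟨2*k+1, cycleG (2*k+1), fun _ => 1,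
      ⟨s(_, _), cyc_edge (2*k+1) (by omega) ⟨0, by omega⟩⟩, fun _ _ => one_pos, rfl⟩
  unfold sVal
  apply le_antisymm
  · exact (csInf_le ⟨_, hlow⟩ hmem).trans (upper k hk)
  · exact le_csInf ⟨_, hmem⟩ hlow
end
end

section
/- Let G be a non-empty graph (a finite simple graph with at least one edge) admitting a homomorphism to K_r, where r = p/q is a rational in lowest terms with p ≥ 2q. Then s(K_2, G) ≥ s(K_2, K_r). If, additionally, G contains an odd cycle of length at most 2k+1 for an integer k ≥ 1, then s(C_{2k+1}, G) ≥ s(C_{2k+1}, K_r). -/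
open scoped Classical

noncomputable section

lemma cutWeight_nonneg' {α β : Type} [Fintype α] (G : SimpleGraph α) (H : SimpleGraph β)
    (w : Sym2 α → ℚ) (hw : ∀ e ∈ G.edgeSet, 0 < w e) (f : α → β) : 0 ≤ cutWeight G H w f := by
  unfold cutWeight
  apply Finset.sum_nonneg
  intro e he
  have := hw e (Finset.mem_filter.1 he).2.1
  exact_mod_cast this.le

lemma mcMax_nonneg' {α β : Type} [Fintype α] (G : SimpleGraph α) (H : SimpleGraph β)
    (w : Sym2 α → ℚ) (hw : ∀ e ∈ G.edgeSet, 0 < w e) : 0 ≤ mcMax H G w :=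
  Real.iSup_nonneg (fun f => cutWeight_nonneg' G H w hw f)

lemma mcMax_pos' {α β : Type} [Fintype α] [Fintype β] (G : SimpleGraph α) (H : SimpleGraph β)
    (w : Sym2 α → ℚ) (hw : ∀ e ∈ G.edgeSet, 0 < w e) (hG : G.edgeSet.Nonempty)
    (hH : H.edgeSet.Nonempty) : 0 < mcMax H G w := by
  obtain ⟨e, he⟩ := hG
  obtain ⟨e', he'⟩ := hH
  induction e using Sym2.ind with | _ a b =>
  induction e' using Sym2.ind with | _ u v =>
  have hab : a ≠ b := G.ne_of_adj he
  let f : α → β := fun x => if x = a then u else v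
  refine lt_of_lt_of_le ?_ (le_ciSup (Set.finite_range _).bddAbove f)
  unfold cutWeight
  apply Finset.sum_pos
  · intro e he
    have := hw e (Finset.mem_filter.1 he).2.1
    exact_mod_cast this
  · refine ⟨s(a, b), ?_⟩
    rw [Finset.mem_filter]
    refine ⟨Finset.mem_univ _, he, ?_⟩
    have h1 : f a = u := if_pos rfl
    have h2 : f b = v := if_neg hab.symm
    rw [Sym2.map_mk, h1, h2]
    exact he'

lemma mcMax_mono' {α β γ : Type} [Fintype α] [Fintype β] [Fintype γ] [Nonempty β]
    (G : SimpleGraph α) (H : SimpleGraph β) (H' : SimpleGraph γ) (φ : H →g H')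
    (w : Sym2 α → ℚ) (hw : ∀ e ∈ G.edgeSet, 0 < w e) : mcMax H G w ≤ mcMax H' G w := by
  apply ciSup_le
  intro f
  refine le_trans ?_ (le_ciSup (Set.finite_range _).bddAbove (φ ∘ f))
  unfold cutWeight
  apply Finset.sum_le_sum_of_subset_of_nonneg
  · intro e he
    rw [Finset.mem_filter] at he ⊢
    refine ⟨he.1, he.2.1, ?_⟩
    have h := he.2.2
    clear he
    induction e using Sym2.ind with | _ a b =>
    rw [Sym2.map_mk] at h ⊢
    exact φ.map_adj h
  · intro e he _
    have := hw e (Finset.mem_filter.1 he).2.1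
    exact_mod_cast this.le

lemma sVal_mono' {α β γ : Type} [Fintype β] [Fintype γ]
    (M : SimpleGraph α) (H : SimpleGraph β) (H' : SimpleGraph γ) (φ : H →g H')
    (hH : H.edgeSet.Nonempty) : sVal M H' ≤ sVal M H := by
  have : Nonempty β := by
    obtain ⟨e, _⟩ := hH
    induction e using Sym2.ind with | _ u v =>
    exact ⟨u⟩
  unfold sVal
  apply le_csInf
  · refine ⟨_, 2, ⊤, fun _ => 1, ⟨s(0, 1), ?_⟩, fun _ _ => one_pos, rfl⟩
    simp
  · rintro x ⟨n, G, w, hG, hw, rfl⟩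
    refine le_trans (csInf_le ⟨0, ?_⟩ ⟨n, G, w, hG, hw, rfl⟩) ?_
    · rintro y ⟨n, G, w, hG, hw, rfl⟩
      exact div_nonneg (mcMax_nonneg' _ _ _ hw) (mcMax_nonneg' _ _ _ hw)
    · exact div_le_div_of_nonneg_left (mcMax_nonneg' _ _ _ hw) (mcMax_pos' _ _ _ hw hG hH)
        (mcMax_mono' _ _ _ φ w hw)

theorem stmt7 {V : Type} [Fintype V] (G : SimpleGraph V) (hG : G.edgeSet.Nonempty)
    (p q : ℕ) (hq : 1 ≤ q) (hpq : 2*q ≤ p) (hcop : Nat.Coprime p q)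
    (hhom : Nonempty (G →g circK p q)) (k : ℕ) (hk : 1 ≤ k) :
    sVal K2 G ≥ sVal K2 (circK p q) ∧
    ((∃ (v : V) (c : G.Walk v v), c.IsCycle ∧ Odd c.length ∧ c.length ≤ 2*k+1) →
      sVal (cycleG (2*k+1)) G ≥ sVal (cycleG (2*k+1)) (circK p q)) := by
  obtain ⟨φ⟩ := hhom
  exact ⟨sVal_mono' _ _ _ φ hG, fun _ => sVal_mono' _ _ _ φ hG⟩
end
end

section
/- Let G be a finite simple graph with at least one edge containing no K_4 minor, and let k ≥ 1 be an integer. If every odd cycle of G has length at least 6k−1, then s(K_2, G) ≥ 4k/(4k+1). If every odd cycle of G has length at least 6k+3, then s(K_2, G) ≥ (4k+2)/(4k+3). -/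
open scoped Classical

noncomputable section

/-- `H` is a minor of `G`: there are pairwise disjoint nonempty connected branch sets in `G`,
one for each vertex of `H`, with an edge of `G` between the branch sets of any two
adjacent vertices of `H`. -/
def HasMinor {V W : Type} (G : SimpleGraph V) (H : SimpleGraph W) : Prop :=
  ∃ B : W → Set V,
    (∀ w, (B w).Nonempty) ∧
    (∀ w, (SimpleGraph.induce (B w) G).Connected) ∧
    (∀ w₁ w₂, w₁ ≠ w₂ → Disjoint (B w₁) (B w₂)) ∧
    (∀ w₁ w₂, H.Adj w₁ w₂ → ∃ u ∈ B w₁, ∃ v ∈ B w₂, G.Adj u v)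


namespace S8

open SimpleGraph

theorem oddwalk_aux {V : Type} (G : SimpleGraph V) {u v : V} (p : G.Walk u v) :
    (∃ (z : V) (c : G.Walk z z), c.IsCycle ∧ Odd c.length ∧ c.length ≤ p.length) ∨
    (∃ q : G.Walk u v, q.IsPath ∧ q.length ≤ p.length ∧ (Odd q.length ↔ Odd p.length)) := by
  induction p with
  | nil => exact Or.inr ⟨Walk.nil, by simp, le_rfl, Iff.rfl⟩
  | @cons u u' v h p ih =>
    rcases ih with ⟨z, c, hc, ho, hl⟩ | ⟨q, hq, hl, ho⟩
    · exact Or.inl ⟨z, c, hc, ho, by simp; omega⟩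
    · by_cases hu : u ∈ q.support
      · have hsp := congrArg Walk.length (q.take_spec hu)
        rw [Walk.length_append] at hsp
        by_cases hm : Odd ((q.takeUntil u hu).length + 1)
        · left
          refine ⟨u, Walk.cons h (q.takeUntil u hu), ?_, by simpa using hm, by simp; omega⟩
          rw [Walk.cons_isCycle_iff]
          refine ⟨hq.takeUntil hu, fun he => ?_⟩
          have := (hq.takeUntil hu).length_eq_one_of_mem_edges (by rwa [Sym2.eq_swap])
          rw [this] at hm
          exact absurd hm (by decide)
        · right
          refine ⟨q.dropUntil u hu, hq.dropUntil hu, by simp; omega, ?_⟩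
          simp only [Walk.length_cons]
          rw [Nat.odd_iff] at *
          rw [Nat.odd_iff] at *
          omega
      · right
        refine ⟨Walk.cons h q, by simp [Walk.cons_isPath_iff, hq, hu], by simp; omega, ?_⟩
        simp only [Walk.length_cons]
        rw [Nat.odd_iff] at *
        rw [Nat.odd_iff] at *
        omega

theorem oddwalk {V : Type} (G : SimpleGraph V) (g : ℕ)
    (hg : ∀ (v : V) (c : G.Walk v v), c.IsCycle → Odd c.length → g ≤ c.length)
    {u : V} (p : G.Walk u u) (hp : Odd p.length) : g ≤ p.length := by
  rcases oddwalk_aux G p with ⟨z, c, hc, ho, hl⟩ | ⟨q, hq, hl, ho⟩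
  · exact (hg z c hc ho).trans hl
  · rw [Walk.isPath_iff_nil, ← Walk.length_eq_zero_iff] at hq
    rw [← ho, hq] at hp
    simp at hp

def Rch {V : Type} (G : SimpleGraph V) (S : Set V) (u v : V) : Prop :=
  ∃ (hu : u ∈ S) (hv : v ∈ S), (G.induce S).Reachable ⟨u, hu⟩ ⟨v, hv⟩

theorem Rch.trans {V : Type} {G : SimpleGraph V} {S : Set V} {u v w : V}
    (h : Rch G S u v) (h' : Rch G S v w) : Rch G S u w := by
  obtain ⟨hu, hv, r⟩ := h
  obtain ⟨_, hw, r'⟩ := h'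
  exact ⟨hu, hw, r.trans r'⟩

theorem Rch.mono {V : Type} {G : SimpleGraph V} {S T : Set V} (hST : S ⊆ T) {u v : V}
    (h : Rch G S u v) : Rch G T u v := by
  obtain ⟨hu, hv, r⟩ := h
  exact ⟨hST hu, hST hv, r.map (induceHomOfLE _ hST).toHom⟩

theorem Rch.adj {V : Type} {G : SimpleGraph V} {S : Set V} {u v : V}
    (hu : u ∈ S) (hv : v ∈ S) (h : G.Adj u v) : Rch G S u v :=
  ⟨hu, hv, Adj.reachable (by simpa using h)⟩

theorem Rch.conn {V : Type} {G : SimpleGraph V} {S : Set V} (u : V) (hu : u ∈ S)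
    (h : ∀ v ∈ S, Rch G S u v) : (G.induce S).Connected := by
  rw [connected_iff_exists_forall_reachable]
  refine ⟨⟨u, hu⟩, ?_⟩
  rintro ⟨v, hv⟩
  exact (h v hv).2.2

theorem Rch.of_conn {V : Type} {G : SimpleGraph V} {S : Set V} (h : (G.induce S).Connected)
    {u v : V} (hu : u ∈ S) (hv : v ∈ S) : Rch G S u v :=
  ⟨hu, hv, h.preconnected _ _⟩

theorem HasMinor_trans {V V' W : Type} {G : SimpleGraph V} {G' : SimpleGraph V'}
    {H : SimpleGraph W} (h1 : HasMinor G G') (h2 : HasMinor G' H) : HasMinor G H := by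
  obtain ⟨M, Mn, Mc, Md, Ma⟩ := h1
  obtain ⟨B, Bn, Bc, Bd, Ba⟩ := h2
  refine ⟨fun w => ⋃ v ∈ B w, M v, ?_, ?_, ?_, ?_⟩
  · intro w
    obtain ⟨v, hv⟩ := Bn w
    obtain ⟨u, hu⟩ := Mn v
    exact ⟨u, Set.mem_biUnion hv hu⟩
  · intro w
    have key : ∀ (x y : B w), (G'.induce (B w)).Reachable x y → ∀ u ∈ M x, ∀ u' ∈ M y,
        Rch G (⋃ v ∈ B w, M v) u u' := by
      rintro x y ⟨p⟩
      induction p with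
      | @nil x =>
        intro u hu u' hu'
        exact (Rch.of_conn (Mc x) hu hu').mono (Set.subset_biUnion_of_mem x.2)
      | @cons x z y h p ih =>
        intro u hu u' hu'
        have h' : G'.Adj x z := by simpa using h
        obtain ⟨a, ha, b, hb, hab⟩ := Ma _ _ h'
        refine ((Rch.of_conn (Mc x) hu ha).mono (Set.subset_biUnion_of_mem x.2)).trans
          ((Rch.adj (Set.mem_biUnion x.2 ha) (Set.mem_biUnion z.2 hb) hab).trans
            (ih b hb u' hu'))
    obtain ⟨v, hv⟩ := Bn w
    obtain ⟨u, hu⟩ := Mn v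
    refine Rch.conn u (Set.mem_biUnion hv hu) ?_
    intro u' hu'
    simp only [Set.mem_iUnion] at hu'
    obtain ⟨v', hv', hu'⟩ := hu'
    exact key ⟨v, hv⟩ ⟨v', hv'⟩ ((Bc w).preconnected _ _) u hu u' hu'
  · intro w₁ w₂ hne
    rw [Set.disjoint_left]
    intro u h1 h2
    simp only [Set.mem_iUnion] at h1 h2
    obtain ⟨a, ha, hua⟩ := h1
    obtain ⟨b, hb, hub⟩ := h2
    by_cases hab : a = b
    · subst hab
      exact Set.disjoint_left.1 (Bd _ _ hne) ha hb
    · exact Set.disjoint_left.1 (Md _ _ hab) hua hub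
  · intro w₁ w₂ hadj
    obtain ⟨a, ha, b, hb, hab⟩ := Ba _ _ hadj
    obtain ⟨u, hu, v, hv, huv⟩ := Ma _ _ hab
    exact ⟨u, Set.mem_biUnion ha hu, v, Set.mem_biUnion hb hv, huv⟩

theorem conn_singleton {V : Type} (G : SimpleGraph V) (v : V) :
    (G.induce ({v} : Set V)).Connected := by
  refine Rch.conn v rfl ?_
  rintro u rfl
  exact ⟨rfl, rfl, Reachable.refl _⟩

theorem conn_pair {V : Type} (G : SimpleGraph V) {a b : V} (h : G.Adj a b) :
    (G.induce ({a, b} : Set V)).Connected := by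
  refine Rch.conn a (by simp) ?_
  rintro u (rfl | rfl)
  · exact ⟨by simp, by simp, Reachable.refl _⟩
  · exact Rch.adj (by simp) (by simp) h

theorem minor_induce {V : Type} (G : SimpleGraph V) (S : Set V) :
    HasMinor G (G.induce S) := by
  refine ⟨fun v => {v.1}, fun w => ⟨_, rfl⟩, fun w => conn_singleton _ _, ?_, ?_⟩
  · intro a b hab
    simpa [Subtype.ext_iff] using fun h => hab (Subtype.ext h)
  · intro a b hab
    exact ⟨a, rfl, b, rfl, by simpa using hab⟩

/-- contract `a` into `s` -/
def contr {V : Type} (G : SimpleGraph V) (s a : V) : SimpleGraph {u : V // u ≠ a} where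
  Adj u w := u ≠ w ∧ (G.Adj u w ∨ (u.1 = s ∧ G.Adj a w) ∨ (w.1 = s ∧ G.Adj a u))
  symm := ⟨by
    rintro u w ⟨h, h' | h' | h'⟩
    · exact ⟨h.symm, Or.inl h'.symm⟩
    · exact ⟨h.symm, Or.inr (Or.inr h')⟩
    · exact ⟨h.symm, Or.inr (Or.inl h')⟩⟩
  loopless := ⟨fun u h => h.1 rfl⟩

theorem minor_contr {V : Type} (G : SimpleGraph V) {s a : V} (h : G.Adj s a) :
    HasMinor G (contr G s a) := by
  refine ⟨fun v => if v.1 = s then {s, a} else {v.1}, ?_, ?_, ?_, ?_⟩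
  · intro w
    dsimp only
    split_ifs <;> simp
  · intro w
    by_cases hw : w.1 = s
    · dsimp only; rw [if_pos hw]; exact conn_pair G h
    · dsimp only; rw [if_neg hw]; exact conn_singleton _ _
  · rintro ⟨x, hx⟩ ⟨y, hy⟩ hxy
    have hxy' : x ≠ y := fun e => hxy (Subtype.ext e)
    dsimp only
    split_ifs with h1 h2 h2
    · exact absurd (h1.trans h2.symm) hxy'
    · simp [hy, h2]
    · simp only [Set.disjoint_singleton_left]; simp [hx, h1]
    · simpa using hxy'
  · rintro ⟨x, hx⟩ ⟨y, hy⟩ ⟨_, h' | ⟨h1, h2⟩ | ⟨h1, h2⟩⟩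
    · refine ⟨x, ?_, y, ?_, h'⟩ <;> dsimp only <;> split_ifs <;> simp_all
    · refine ⟨a, ?_, y, ?_, h2⟩ <;> dsimp only <;> split_ifs <;> simp_all
    · refine ⟨x, ?_, a, ?_, h2.symm⟩ <;> dsimp only <;> split_ifs <;> simp_all

def SmallV {V : Type} (G : SimpleGraph V) (v : V) : Prop :=
  ∃ a b, ∀ u, G.Adj v u → u = a ∨ u = b

abbrev K4 : SimpleGraph (Fin 4) := ⊤

def IHyp (n : ℕ) : Prop :=
  ∀ (V : Type) [Fintype V] (G : SimpleGraph V), Fintype.card V < n → ¬ HasMinor G K4 →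
    ∀ s t z : V, G.Adj s t → z ≠ s → z ≠ t → ∃ v, v ≠ s ∧ v ≠ t ∧ SmallV G v

theorem closedSet {V : Type} [Fintype V] (G : SimpleGraph V) (ih : IHyp (Fintype.card V))
    (hm : ¬ HasMinor G K4) (D : Set V) (x y z o : V) (hxy : G.Adj x y)
    (hx : x ∉ D) (hy : y ∉ D) (hz : z ∈ D) (ho : o ∉ D) (hox : o ≠ x) (hoy : o ≠ y)
    (hD : ∀ u ∈ D, ∀ w, G.Adj u w → w ∈ D ∨ w = x ∨ w = y) :
    ∃ v ∈ D, SmallV G v := by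
  let S : Set V := {u | u ∈ D ∨ u = x ∨ u = y}
  have hcard : Fintype.card S < Fintype.card V := by
    apply Fintype.card_subtype_lt (x := o)
    rintro (h | h | h)
    · exact ho h
    · exact hox h
    · exact hoy h
  obtain ⟨v, hvx, hvy, a, b, hab⟩ := ih S (G.induce S) hcard
    (fun h => hm (HasMinor_trans (minor_induce G S) h))
    ⟨x, Or.inr (Or.inl rfl)⟩ ⟨y, Or.inr (Or.inr rfl)⟩ ⟨z, Or.inl hz⟩ (by simpa using hxy)
    (fun h => hx (by have e : z = x := congrArg Subtype.val h; rwa [← e]))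
    (fun h => hy (by have e : z = y := congrArg Subtype.val h; rwa [← e]))
  have hvD : v.1 ∈ D := by
    rcases v.2 with h | h | h
    · exact h
    · exact absurd (Subtype.ext h) hvx
    · exact absurd (Subtype.ext h) hvy
  refine ⟨v, hvD, a, b, fun u hu => ?_⟩
  have := hab ⟨u, hD v hvD u hu⟩ (by simpa using hu)
  simpa [Subtype.ext_iff] using this

theorem contrStep {V : Type} [Fintype V] (G : SimpleGraph V) (ih : IHyp (Fintype.card V))
    (hm : ¬ HasMinor G K4) (s t a : V) (hst : G.Adj s t) (hsa : G.Adj s a) (hat : a ≠ t)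
    (hns : ∀ v, v ≠ s → v ≠ t → ¬ SmallV G v) :
    ∃ v q, v ≠ s ∧ v ≠ t ∧ G.Adj v s ∧ G.Adj v a ∧ G.Adj v q ∧ q ≠ s ∧ q ≠ a ∧
      ∀ u, G.Adj v u → u = s ∨ u = a ∨ u = q := by
  have has : a ≠ s := hsa.ne'
  obtain ⟨z, hza, hzs, hzt⟩ : ∃ z, G.Adj a z ∧ z ≠ s ∧ z ≠ t := by
    by_contra hcon
    push Not at hcon
    refine hns a has hat ⟨s, t, fun u hu => ?_⟩
    by_cases h : u = s
    · exact Or.inl h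
    · exact Or.inr (hcon u hu h)
  have hcard : Fintype.card {u : V // u ≠ a} < Fintype.card V :=
    Fintype.card_subtype_lt (x := a) (by simp)
  obtain ⟨⟨v, hva⟩, hvs, hvt, ⟨p, hpa⟩, ⟨q, hqa⟩, hpq⟩ := ih {u : V // u ≠ a} (contr G s a) hcard
    (fun h => hm (HasMinor_trans (minor_contr G hsa) h))
    ⟨s, has.symm⟩ ⟨t, hat.symm⟩ ⟨z, hza.ne'⟩ 
    ⟨by simpa using hst.ne, Or.inl hst⟩ (by simpa using hzs) (by simpa using hzt)
  have hvs' : v ≠ s := by simpa using hvs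
  have hvt' : v ≠ t := by simpa using hvt
  have hn := hns v hvs' hvt'
  have h1 : ∀ u, u ≠ a → G.Adj v u → u = p ∨ u = q := by
    intro u hu h
    have := hpq ⟨u, hu⟩ ⟨by simpa using h.ne, Or.inl h⟩
    simpa using this
  have h2 : G.Adj v a → s = p ∨ s = q := by
    intro h
    have := hpq ⟨s, has.symm⟩ ⟨by simpa using hvs', Or.inr (Or.inr ⟨rfl, h.symm⟩)⟩
    simpa using this
  have hA : G.Adj v a := by
    by_contra hA
    refine hn ⟨p, q, fun u hu => h1 u ?_ hu⟩
    rintro rfl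
    exact hA hu
  have key : ∃ q, ∀ u, G.Adj v u → u = s ∨ u = a ∨ u = q := by
    rcases h2 hA with rfl | rfl
    · refine ⟨q, fun u hu => ?_⟩
      by_cases h : u = a
      · exact Or.inr (Or.inl h)
      · rcases h1 u h hu with h | h <;> simp [h]
    · refine ⟨p, fun u hu => ?_⟩
      by_cases h : u = a
      · exact Or.inr (Or.inl h)
      · rcases h1 u h hu with h | h <;> simp [h]
  obtain ⟨r, hr⟩ := key
  have hS : G.Adj v s := by
    by_contra hS
    refine hn ⟨a, r, fun u hu => ?_⟩
    rcases hr u hu with rfl | h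
    · exact absurd hu hS
    · exact h
  have hR : G.Adj v r ∧ r ≠ s ∧ r ≠ a := by
    by_contra hR
    refine hn ⟨s, a, fun u hu => ?_⟩
    rcases hr u hu with h | h | h
    · exact Or.inl h
    · exact Or.inr h
    · subst h
      by_contra hc
      push Not at hc
      exact hR ⟨hu, hc.1, hc.2⟩
  exact ⟨v, r, hvs', hvt', hS, hA, hR.1, hR.2.1, hR.2.2, hr⟩

/-- the component of `y` in the graph induced on `S` -/
def comp {V : Type} (G : SimpleGraph V) (S : Set V) (y : V) : Set V :=
  {u | Rch G S y u}

theorem comp_conn {V : Type} (G : SimpleGraph V) (S : Set V) (y : V) (hy : y ∈ S) :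
    (G.induce (comp G S y)).Connected := by
  have hyy : y ∈ comp G S y := ⟨hy, hy, Reachable.refl _⟩
  refine Rch.conn y hyy ?_
  have key : ∀ (b c : S), (G.induce S).Reachable b c → b.1 ∈ comp G S y →
      Rch G (comp G S y) b c := by
    rintro b c ⟨p⟩
    induction p with
    | nil => intro h; exact ⟨h, h, Reachable.refl _⟩
    | @cons b d c h p ih =>
      intro hb
      have h' : G.Adj b d := by simpa using h
      have hd : d.1 ∈ comp G S y := Rch.trans hb (Rch.adj b.2 d.2 h')
      exact (Rch.adj hb hd h').trans (ih hd)
  rintro v ⟨h1, h2, h3⟩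
  exact key _ _ h3 hyy

theorem comp_closed {V : Type} (G : SimpleGraph V) (S : Set V) (y u w : V)
    (hu : u ∈ comp G S y) (h : G.Adj u w) (hw : w ∈ S) : w ∈ comp G S y :=
  Rch.trans hu (Rch.adj hu.2.1 hw h)

theorem mkK4 {V : Type} (G : SimpleGraph V) (a b c : V) (D : Set V) (hab : G.Adj a b)
    (hac : G.Adj a c) (hbc : G.Adj b c) (hD : (G.induce D).Connected)
    (ha : a ∉ D) (hb : b ∉ D) (hc : c ∉ D)
    (hda : ∃ u ∈ D, G.Adj a u) (hdb : ∃ u ∈ D, G.Adj b u) (hdc : ∃ u ∈ D, G.Adj c u) :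
    HasMinor G K4 := by
  obtain ⟨u1, hu1, h1⟩ := hda
  obtain ⟨u2, hu2, h2⟩ := hdb
  obtain ⟨u3, hu3, h3⟩ := hdc
  have e1 := hab.ne
  have e2 := hac.ne
  have e3 := hbc.ne
  refine ⟨![{a}, {b}, {c}, D], ?_, ?_, ?_, ?_⟩
  · intro i
    fin_cases i
    · exact ⟨a, rfl⟩
    · exact ⟨b, rfl⟩
    · exact ⟨c, rfl⟩
    · exact ⟨u1, hu1⟩
  · intro i
    fin_cases i
    · exact conn_singleton _ _
    · exact conn_singleton _ _
    · exact conn_singleton _ _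
    · exact hD
  · intro i j hij
    fin_cases i <;> fin_cases j <;> simp_all [Ne.symm]
  · intro i j hij
    fin_cases i <;> fin_cases j
    · exact absurd rfl hij
    · exact ⟨a, rfl, b, rfl, hab⟩
    · exact ⟨a, rfl, c, rfl, hac⟩
    · exact ⟨a, rfl, u1, hu1, h1⟩
    · exact ⟨b, rfl, a, rfl, hab.symm⟩
    · exact absurd rfl hij
    · exact ⟨b, rfl, c, rfl, hbc⟩
    · exact ⟨b, rfl, u2, hu2, h2⟩
    · exact ⟨c, rfl, a, rfl, hac.symm⟩
    · exact ⟨c, rfl, b, rfl, hbc.symm⟩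
    · exact absurd rfl hij
    · exact ⟨c, rfl, u3, hu3, h3⟩
    · exact ⟨u1, hu1, a, rfl, h1.symm⟩
    · exact ⟨u2, hu2, b, rfl, h2.symm⟩
    · exact ⟨u3, hu3, c, rfl, h3.symm⟩
    · exact absurd rfl hij

theorem coreStep {V : Type} [Fintype V] (G : SimpleGraph V) (ih : IHyp (Fintype.card V))
    (hm : ¬ HasMinor G K4) (s t a : V) (hst : G.Adj s t) (hsa : G.Adj s a) (hat : a ≠ t)
    (hns : ∀ v, v ≠ s → v ≠ t → ¬ SmallV G v) : False := by
  obtain ⟨v₁, q, h1s, h1t, a1s, a1a, a1q, hqs, hqa, hn1⟩ :=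
    contrStep G ih hm s t a hst hsa hat hns
  obtain ⟨v₂, y₁, h2s, h2t, a2s, a21, a2y, hy1s, hy11, hn2⟩ :=
    contrStep G ih hm s t v₁ hst a1s.symm h1t hns
  obtain ⟨y₀, a1y, hy0s, hy02, hn1'⟩ : ∃ y₀, G.Adj v₁ y₀ ∧ y₀ ≠ s ∧ y₀ ≠ v₂ ∧
      ∀ u, G.Adj v₁ u → u = s ∨ u = v₂ ∨ u = y₀ := by
    rcases hn1 v₂ a21.symm with h | h | h
    · exact absurd h h2s
    · subst h
      exact ⟨q, a1q, hqs, hqa, hn1⟩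
    · subst h
      refine ⟨a, a1a, hsa.ne', hqa.symm, fun u hu => ?_⟩
      have := hn1 u hu
      tauto
  have hy12 : y₁ ≠ v₂ := a2y.ne'
  have hy01 : y₀ ≠ v₁ := a1y.ne'
  have h12 : v₁ ≠ v₂ := a21.ne'
  let S : Set V := {u | u ≠ s ∧ u ≠ v₁ ∧ u ≠ v₂}
  have hy0S : y₀ ∈ S := ⟨hy0s, hy01, hy02⟩
  have hy1S : y₁ ∈ S := ⟨hy1s, hy11, hy12⟩
  have sub : ∀ y, ∀ u ∈ comp G S y, u ∈ S := fun y u hu => hu.2.1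
  have memself : ∀ y ∈ S, y ∈ comp G S y := fun y hy => ⟨hy, hy, Reachable.refl _⟩
  have sn : ∀ y, s ∉ comp G S y := fun y h => (sub y s h).1 rfl
  have n1 : ∀ y, v₁ ∉ comp G S y := fun y h => (sub y _ h).2.1 rfl
  have n2 : ∀ y, v₂ ∉ comp G S y := fun y h => (sub y _ h).2.2 rfl
  by_cases hsame : y₁ ∈ comp G S y₀
  · by_cases hadj : ∃ u ∈ comp G S y₀, G.Adj s u
    · exact hm (mkK4 G s v₁ v₂ (comp G S y₀) a1s.symm a2s.symm a21.symm
        (comp_conn G S y₀ hy0S) (sn _) (n1 _) (n2 _) hadj ⟨y₀, memself _ hy0S, a1y⟩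
        ⟨y₁, hsame, a2y⟩)
    · push Not at hadj
      obtain ⟨v, hv, hsm⟩ := closedSet G ih hm (comp G S y₀) v₁ v₂ y₀ s a21.symm (n1 _) (n2 _)
        (memself _ hy0S) (sn _) h1s.symm h2s.symm (by
          intro u hu w huw
          by_cases hw : w ∈ S
          · exact Or.inl (comp_closed G S y₀ u w hu huw hw)
          · right
            by_contra hc
            push Not at hc
            refine hw ⟨?_, hc.1, hc.2⟩
            rintro rfl
            exact hadj u hu huw.symm)
      refine hns v ?_ ?_ hsm
      · rintro rfl
        exact sn _ hv
      · rintro rfl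
        exact hadj _ hv hst
  · by_cases ht : t ∈ comp G S y₀
    · -- use component of y₁
      have htn : t ∉ comp G S y₁ := by
        intro h
        apply hsame
        obtain ⟨p1, p2, p3⟩ := h
        exact Rch.trans ht ⟨p2, p1, p3.symm⟩
      obtain ⟨v, hv, hsm⟩ := closedSet G ih hm (comp G S y₁) s v₂ y₁ v₁ a2s.symm (sn _) (n2 _)
        (memself _ hy1S) (n1 _) h1s h12 (by
          intro u hu w huw
          by_cases hw : w ∈ S
          · exact Or.inl (comp_closed G S y₁ u w hu huw hw)
          · right
            by_contra hc
            push Not at hc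
            refine hw ⟨hc.1, ?_, hc.2⟩
            rintro rfl
            rcases hn1' u huw.symm with rfl | rfl | rfl
            · exact sn _ hu
            · exact n2 _ hu
            · apply hsame
              obtain ⟨p1, p2, p3⟩ := hu
              exact ⟨p2, p1, p3.symm⟩)
      refine hns v ?_ ?_ hsm
      · rintro rfl
        exact sn _ hv
      · rintro rfl
        exact htn hv
    · obtain ⟨v, hv, hsm⟩ := closedSet G ih hm (comp G S y₀) s v₁ y₀ v₂ a1s.symm (sn _) (n1 _)
        (memself _ hy0S) (n2 _) h2s h12.symm (by
          intro u hu w huw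
          by_cases hw : w ∈ S
          · exact Or.inl (comp_closed G S y₀ u w hu huw hw)
          · right
            by_contra hc
            push Not at hc
            refine hw ⟨hc.1, hc.2, ?_⟩
            rintro rfl
            rcases hn2 u huw.symm with rfl | rfl | rfl
            · exact sn _ hu
            · exact n1 _ hu
            · exact hsame hu)
      refine hns v ?_ ?_ hsm
      · rintro rfl
        exact sn _ hv
      · rintro rfl
        exact ht hv

theorem smallMain (n : ℕ) : IHyp n := by
  induction n with
  | zero => intro V _ G h; exact absurd h (Nat.not_lt_zero _)
  | succ n IH =>
    intro V _ G hc hm s t z hst hzs hzt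
    have ih : IHyp (Fintype.card V) := by
      intro V' _ G' hc' 
      exact IH V' G' (by omega)
    by_contra hcon
    have hns : ∀ v, v ≠ s → v ≠ t → ¬ SmallV G v := by
      intro v h1 h2 h3
      exact hcon ⟨v, h1, h2, h3⟩
    have hs : ∀ a, G.Adj s a → a = t := by
      intro a h
      by_contra hat
      exact coreStep G ih hm s t a hst h hat hns
    have ht : ∀ a, G.Adj t a → a = s := by
      intro a h
      by_contra hat
      exact coreStep G ih hm t s a hst.symm h hat (fun v h1 h2 => hns v h2 h1)
    obtain ⟨y, hzy⟩ : ∃ y, G.Adj z y := by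
      by_contra h
      push Not at h
      exact hns z hzs hzt ⟨s, t, fun u hu => absurd hu (h u)⟩
    obtain ⟨x, hzx, hxy⟩ : ∃ x, G.Adj z x ∧ x ≠ y := by
      by_contra h
      push Not at h
      exact hns z hzs hzt ⟨y, y, fun u hu => Or.inl (h u hu)⟩
    have nos : ∀ u, u ≠ t → ¬ G.Adj u s := fun u hu h => hu (hs u h.symm)
    have notn : ∀ u, u ≠ s → ¬ G.Adj u t := fun u hu h => hu (ht u h.symm)
    have av : ∀ w, G.Adj z w → w ≠ s ∧ w ≠ t := by
      intro w h
      constructor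
      · rintro rfl; exact nos z hzt h
      · rintro rfl; exact notn z hzs h
    obtain ⟨v, hv, hsm⟩ := closedSet G ih hm {u | u ≠ s ∧ u ≠ t ∧ u ≠ z ∧ u ≠ y} z y x s hzy
      (by simp) (by simp) ⟨(av x hzx).1, (av x hzx).2, hzx.ne', hxy⟩ (by simp) hzs.symm
      (av y hzy).1.symm (by
        rintro u ⟨h1, h2, h3, h4⟩ w huw
        by_contra hc
        push Not at hc
        apply hc.1
        refine ⟨?_, ?_, hc.2.1, hc.2.2⟩
        · rintro rfl; exact nos u h2 huw
        · rintro rfl; exact notn u h1 huw)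
    exact hns v hv.1 hv.2.1 hsm

theorem exists_small {V : Type} [Fintype V] [Nonempty V] (G : SimpleGraph V)
    (hm : ¬ HasMinor G K4) : ∃ v, SmallV G v := by
  by_cases h : ∃ s t, G.Adj s t
  · obtain ⟨s, t, hst⟩ := h
    by_cases hz : ∃ z, z ≠ s ∧ z ≠ t
    · obtain ⟨z, h1, h2⟩ := hz
      obtain ⟨v, _, _, hv⟩ := smallMain _ V G (Nat.lt_succ_self _) hm s t z hst h1 h2
      exact ⟨v, hv⟩
    · push Not at hz
      refine ⟨s, s, t, fun u _ => ?_⟩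
      by_cases h : u = s
      · exact Or.inl h
      · exact Or.inr (hz u h)
  · push Not at h
    obtain ⟨v⟩ := ‹Nonempty V›
    exact ⟨v, v, v, fun u hu => absurd hu (h v u)⟩

structure Met {V : Type} (x : V → V → ℝ) : Prop where
  sym : ∀ u v, x u v = x v u
  self : ∀ u, x u u = 0
  tri : ∀ u v w, x u w ≤ x u v + x v w
  per : ∀ u v w, x u v + x v w + x u w ≤ 2

def HasDist {V : Type} (G : SimpleGraph V) (x : V → V → ℝ) : Prop :=
  ∃ (Ω : Type) (_ : Fintype Ω) (μ : Ω → ℝ) (X : Ω → V → Bool),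
    (∀ ω, 0 ≤ μ ω) ∧ ∑ ω, μ ω = 1 ∧
    ∀ u v, G.Adj u v → ∑ ω, (if X ω u ≠ X ω v then μ ω else 0) = x u v

theorem exists_frac (n d : ℝ) (h0 : 0 ≤ n) (h1 : n ≤ d) : ∃ α : ℝ, 0 ≤ α ∧ α ≤ 1 ∧ α * d = n := by
  by_cases hd : d = 0
  · exact ⟨0, le_rfl, zero_le_one, by rw [hd] at h1; linarith⟩
  · have : 0 < d := lt_of_le_of_ne (h0.trans h1) (Ne.symm hd)
    exact ⟨n / d, by positivity, (div_le_one this).2 h1, by field_simp⟩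

theorem hasDist_main (n : ℕ) : ∀ (V : Type) [Fintype V] (G : SimpleGraph V) (x : V → V → ℝ),
    Fintype.card V ≤ n → ¬ HasMinor G K4 → Met x → HasDist G x := by
  induction n with
  | zero =>
    intro V _ G x hc _ _
    have : IsEmpty V := Fintype.card_eq_zero_iff.1 (by omega)
    exact ⟨Unit, inferInstance, fun _ => 1, fun _ _ => false, fun _ => zero_le_one, by simp,
      fun u => (this.false u).elim⟩
  | succ n IH =>
    intro V _ G x hc hm hx
    by_cases hne : Nonempty V
    swap
    · exact ⟨Unit, inferInstance, fun _ => 1, fun _ _ => false, fun _ => zero_le_one, by simp,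
        fun u => (hne ⟨u⟩).elim⟩
    obtain ⟨v, p, q, hpq⟩ := exists_small G hm
    have hcard : Fintype.card {u : V // u ≠ v} < Fintype.card V :=
      Fintype.card_subtype_lt (x := v) (by simp)
    have hx' : Met (fun u w : {u : V // u ≠ v} => x u w) :=
      ⟨fun u w => hx.sym _ _, fun u => hx.self _, fun u w z => hx.tri _ _ _,
        fun u w z => hx.per _ _ _⟩
    by_cases hnb : ∃ a, G.Adj v a
    swap
    · push Not at hnb
      obtain ⟨Ω, _, μ, X, h0, h1, h2⟩ := IH {u : V // u ≠ v} (G.induce {u | u ≠ v}) _ (by omega)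
        (fun h => hm (HasMinor_trans (minor_induce G _) h)) hx'
      refine ⟨Ω, inferInstance, μ, fun ω u => if h : u = v then false else X ω ⟨u, h⟩, h0, h1, ?_⟩
      intro u w huw
      have hu : u ≠ v := by rintro rfl; exact hnb _ huw
      have hw : w ≠ v := by rintro rfl; exact hnb _ huw.symm
      have := h2 ⟨u, hu⟩ ⟨w, hw⟩ (by simpa using huw)
      simpa [hu, hw] using this
    · obtain ⟨a, hva⟩ := hnb
      obtain ⟨b, hvb, hab⟩ : ∃ b, G.Adj v b ∧ ∀ u, G.Adj v u → u = a ∨ u = b := by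
        by_cases hb : ∃ b, G.Adj v b ∧ b ≠ a
        · obtain ⟨b, hb, hba⟩ := hb
          refine ⟨b, hb, fun u hu => ?_⟩
          have e1 := hpq a hva
          have e2 := hpq b hb
          have e3 := hpq u hu
          grind
        · push Not at hb
          exact ⟨a, hva, fun u hu => Or.inl (hb u hu)⟩
      have hav : a ≠ v := hva.ne'
      have hbv : b ≠ v := hvb.ne'
      obtain ⟨Ω, _, μ, X, h0, h1, h2⟩ := IH {u : V // u ≠ v} (contr G a v) _ (by omega)
        (fun h => hm (HasMinor_trans (minor_contr G hva.symm) h)) hx'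
      have hE : ∑ ω, (if X ω ⟨a, hav⟩ ≠ X ω ⟨b, hbv⟩ then μ ω else 0) = x a b := by
        by_cases e : a = b
        · subst e
          simp [hx.self]
        · exact h2 ⟨a, hav⟩ ⟨b, hbv⟩ ⟨by simpa using e, Or.inr (Or.inl ⟨rfl, hvb⟩)⟩
      have t1 := hx.tri a v b
      have t2 := hx.tri v a b
      have t3 := hx.tri v b a
      have t4 := hx.per a v b
      have s1 := hx.sym a v
      have s2 := hx.sym b a
      obtain ⟨α, hα0, hα1, hα⟩ := exists_frac ((x v a + x v b - x a b) / 2) (1 - x a b)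
        (by linarith) (by linarith)
      obtain ⟨β, hβ0, hβ1, hβ⟩ := exists_frac ((x v a - x v b + x a b) / 2) (x a b)
        (by linarith) (by linarith)
      let P : Ω → ℝ := fun ω => if X ω ⟨a, hav⟩ ≠ X ω ⟨b, hbv⟩ then β else α
      have hP0 : ∀ ω, 0 ≤ P ω := fun ω => by dsimp only [P]; split_ifs <;> assumption
      have hP1 : ∀ ω, P ω ≤ 1 := fun ω => by dsimp only [P]; split_ifs <;> assumption
      let Y : Ω × Bool → V → Bool := fun ωc u =>
        if h : u = v then xor ωc.2 (X ωc.1 ⟨a, hav⟩) else X ωc.1 ⟨u, h⟩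
      let ν : Ω × Bool → ℝ := fun ωc => μ ωc.1 * (if ωc.2 then P ωc.1 else 1 - P ωc.1)
      have hv : ∀ u, G.Adj v u → ∑ ωc, (if Y ωc v ≠ Y ωc u then ν ωc else 0) = x v u := by
        intro u hu
        rw [Fintype.sum_prod_type]
        simp only [Fintype.sum_bool]
        rcases hab u hu with rfl | rfl
        · have : ∀ ω, ((if Y (ω, true) v ≠ Y (ω, true) u then ν (ω, true) else 0) +
              (if Y (ω, false) v ≠ Y (ω, false) u then ν (ω, false) else 0)) =
              (if X ω ⟨u, hav⟩ ≠ X ω ⟨b, hbv⟩ then μ ω else 0) * β +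
              (μ ω - (if X ω ⟨u, hav⟩ ≠ X ω ⟨b, hbv⟩ then μ ω else 0)) * α := by
            intro ω
            simp only [Y, ν, P, dif_pos, dif_neg hav]
            cases X ω ⟨u, hav⟩ <;> cases X ω ⟨b, hbv⟩ <;> simp
          simp only [this]
          rw [Finset.sum_add_distrib, ← Finset.sum_mul, ← Finset.sum_mul,
            Finset.sum_sub_distrib, hE, h1]
          linarith
        · have : ∀ ω, ((if Y (ω, true) v ≠ Y (ω, true) u then ν (ω, true) else 0) +
              (if Y (ω, false) v ≠ Y (ω, false) u then ν (ω, false) else 0)) =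
              (if X ω ⟨a, hav⟩ ≠ X ω ⟨u, hbv⟩ then μ ω else 0) * (1 - β) +
              (μ ω - (if X ω ⟨a, hav⟩ ≠ X ω ⟨u, hbv⟩ then μ ω else 0)) * α := by
            intro ω
            simp only [Y, ν, P, dif_pos, dif_neg hbv]
            cases X ω ⟨a, hav⟩ <;> cases X ω ⟨u, hbv⟩ <;> simp
          simp only [this]
          rw [Finset.sum_add_distrib, ← Finset.sum_mul, ← Finset.sum_mul,
            Finset.sum_sub_distrib, hE, h1]
          linarith
      refine ⟨Ω × Bool, inferInstance, ν, Y, ?_, ?_, ?_⟩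
      · rintro ⟨ω, c⟩
        refine mul_nonneg (h0 ω) ?_
        have := hP0 ω
        have := hP1 ω
        dsimp only
        split_ifs <;> linarith
      · rw [Fintype.sum_prod_type]
        simp only [Fintype.sum_bool, ν]
        refine Eq.trans (Finset.sum_congr rfl fun ω _ => ?_) h1
        simp
        ring
      · intro u w huw
        by_cases hu : u = v
        · subst hu
          exact hv w huw
        by_cases hw : w = v
        · subst hw
          rw [hx.sym, ← hv u huw.symm]
          refine Finset.sum_congr rfl fun ω _ => ?_
          simp only [ne_comm]
        · have := h2 ⟨u, hu⟩ ⟨w, hw⟩ ⟨by simpa using huw.ne, Or.inl huw⟩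
          dsimp only at this
          rw [← this, Fintype.sum_prod_type]
          refine Finset.sum_congr rfl fun ω _ => ?_
          simp only [Fintype.sum_bool, Y, ν, dif_neg hu, dif_neg hw]
          split_ifs <;> simp_all <;> ring

def bar {V : Type} (p : V × Bool) : V × Bool := (p.1, !p.2)

@[simp] theorem bar_bar {V : Type} (p : V × Bool) : bar (bar p) = p := by
  simp [bar]

structure AM {V : Type} (d : V × Bool → V × Bool → ℝ) : Prop where
  sym : ∀ p q, d p q = d q p
  self : ∀ p, d p p = 0
  tri : ∀ p q r, d p r ≤ d p q + d q r
  le1 : ∀ p q, d p q ≤ 1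
  anti : ∀ p q, d (bar p) (bar q) = d p q
  opp : ∀ p, d p (bar p) = 1

theorem AM.step {V : Type} {d : V × Bool → V × Bool → ℝ} (hd : AM d) (a b : V × Bool) :
    ∃ d', AM d' ∧ (∀ p q, d' p q ≤ d p q) ∧ d' a b + d' a (bar b) = 1 := by
  have nn : ∀ p q, 0 ≤ d p q := fun p q => by
    have := hd.tri p q p
    rw [hd.self, hd.sym q p] at this
    linarith
  obtain ⟨l, hl⟩ : ∃ l, l = 1 - d a b := ⟨_, rfl⟩
  have hl0 : 0 ≤ l := by have := hd.le1 a b; linarith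
  obtain ⟨d', hd'⟩ : ∃ d' : V × Bool → V × Bool → ℝ, ∀ p q, d' p q =
    min (d p q) (min (min (d p a + l + d (bar b) q) (d p (bar b) + l + d a q))
      (min (d p (bar a) + l + d b q) (d p b + l + d (bar a) q))) := ⟨_, fun _ _ => rfl⟩
  have le0 : ∀ p q, d' p q ≤ d p q := fun p q => by rw [hd']; exact min_le_left _ _
  have le1 : ∀ p q, d' p q ≤ d p a + l + d (bar b) q := fun p q => by rw [hd']; simp
  have le2 : ∀ p q, d' p q ≤ d p (bar b) + l + d a q := fun p q => by rw [hd']; simp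
  have le3 : ∀ p q, d' p q ≤ d p (bar a) + l + d b q := fun p q => by rw [hd']; simp
  have le4 : ∀ p q, d' p q ≤ d p b + l + d (bar a) q := fun p q => by rw [hd']; simp
  have cs : ∀ p q, d' p q = d p q ∨ d' p q = d p a + l + d (bar b) q ∨
      d' p q = d p (bar b) + l + d a q ∨ d' p q = d p (bar a) + l + d b q ∨
      d' p q = d p b + l + d (bar a) q := by
    intro p q
    rw [hd']
    grind
  have barl : ∀ p q, d (bar p) q = d p (bar q) := fun p q => by
    rw [← hd.anti p (bar q), bar_bar]
  have e1 : d a (bar a) = 1 := hd.opp a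
  have e2 : d b (bar b) = 1 := hd.opp b
  have e3 : d (bar a) (bar b) = d a b := hd.anti a b
  have e4 : d (bar a) b = d a (bar b) := barl a b
  have hle : d a b ≤ 1 := hd.le1 a b
  have eself := hd.self
  have lb : ∀ p, 1 ≤ d' p (bar p) := by
    intro p
    have o := hd.opp p
    have k1 := hd.tri a p b
    have k2 := hd.sym p a
    have k3 := hd.sym p b
    rcases cs p (bar p) with h | h | h | h | h <;> rw [h]
    · linarith
    · rw [hd.anti]; linarith [hd.sym b p]
    · rw [← barl a p, ← barl p b, hd.sym (bar a) p, ← barl p a, hd.sym (bar p) b,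
        hd.sym (bar p) a, ← barl, ← barl]
      have := hd.tri (bar a) p (bar b)
      rw [e3] at this
      linarith [hd.sym (bar b) p, hd.sym (bar a) p]
    · have := hd.tri (bar a) p (bar b)
      rw [← barl b p]
      linarith [hd.sym (bar b) p, hd.sym (bar a) p]
    · rw [hd.anti]; linarith [hd.sym b p]
  have am : AM d' := by
    refine ⟨?_, ?_, ?_, ?_, ?_, ?_⟩
    · intro p q
      have s0 := hd.sym p q
      have s1 := hd.sym p a
      have s2 := hd.sym p b
      have s3 := hd.sym p (bar a)
      have s4 := hd.sym p (bar b)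
      have s5 := hd.sym q a
      have s6 := hd.sym q b
      have s7 := hd.sym q (bar a)
      have s8 := hd.sym q (bar b)
      apply le_antisymm
      · rcases cs q p with h | h | h | h | h <;>
          linarith [le0 p q, le1 p q, le2 p q, le3 p q, le4 p q]
      · rcases cs p q with h | h | h | h | h <;>
          linarith [le0 q p, le1 q p, le2 q p, le3 q p, le4 q p]
    · intro p
      have := le0 p p
      rw [eself] at this
      apply le_antisymm this
      rcases cs p p with h | h | h | h | h <;> rw [h]
      · rw [eself]
      all_goals
        linarith [nn p a, nn p b, nn p (bar a), nn p (bar b), nn a p, nn b p, nn (bar a) p,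
          nn (bar b) p]
    · intro p q r
      have T := hd.tri
      have S := hd.sym
      have sa := S a q
      have sb := S b q
      have sa' := S (bar a) q
      have sb' := S (bar b) q
      have sba := S b a
      have sba' := S (bar b) (bar a)
      have sx := S (bar b) a
      have sy := S b (bar a)
      have sz := S (bar b) b
      have sw := S (bar a) a
      have nna := nn a q
      have nnb := nn b q
      have nna' := nn (bar a) q
      have nnb' := nn (bar b) q
      have qab := T a q b
      have qab' := T (bar a) q (bar b)
      have qaa := T a q (bar a)
      have qbb := T b q (bar b)
      have c1 := T p a r
      have c2 := T p b r
      have c3 := T p (bar a) r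
      have c4 := T p (bar b) r
      have c5 := T a b r
      have c6 := T b a r
      have c7 := T (bar a) (bar b) r
      have c8 := T (bar b) (bar a) r
      have c9 := T a (bar a) r
      have c10 := T (bar a) a r
      have c11 := T b (bar b) r
      have c12 := T (bar b) b r
      have m0 := le0 p r
      have m1 := le1 p r
      have m2 := le2 p r
      have m3 := le3 p r
      have m4 := le4 p r
      have f0 := T p q r
      have f1 := T p q a
      have f2 := T p q b
      have f3 := T p q (bar a)
      have f4 := T p q (bar b)
      have g1 := T a q r
      have g2 := T b q r
      have g3 := T (bar a) q r
      have g4 := T (bar b) q r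
      rcases cs p q with h | h | h | h | h <;> rcases cs q r with h' | h' | h' | h' | h' <;>
        rw [h, h'] <;> linarith
    · intro p q
      exact (le0 p q).trans (hd.le1 p q)
    · have : ∀ p q, d' (bar p) (bar q) ≤ d' p q := by
        intro p q
        have m0 := le0 (bar p) (bar q)
        have m1 := le1 (bar p) (bar q)
        have m2 := le2 (bar p) (bar q)
        have m3 := le3 (bar p) (bar q)
        have m4 := le4 (bar p) (bar q)
        simp only [hd.anti, barl, bar_bar] at m0 m1 m2 m3 m4
        have z := cs p q
        simp only [barl] at z
        rcases z with h | h | h | h | h <;> linarith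
      intro p q
      apply le_antisymm (this p q)
      simpa using this (bar p) (bar q)
    · intro p
      exact le_antisymm ((le0 _ _).trans (hd.le1 _ _)) (lb p)
  refine ⟨d', am, le0, ?_⟩
  apply le_antisymm
  · have h1 := le0 a b
    have h2 := le1 a (bar b)
    rw [eself, eself] at h2
    linarith
  · have h1 := am.tri b a (bar b)
    rw [am.opp, am.sym b a] at h1
    exact h1

theorem AM.full {V : Type} [Fintype V] {d : V × Bool → V × Bool → ℝ} (hd : AM d) :
    ∃ d', AM d' ∧ (∀ p q, d' p q ≤ d p q) ∧ ∀ p q, d' p q + d' p (bar q) = 1 := by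
  have key : ∀ T : Finset ((V × Bool) × (V × Bool)),
      ∃ d', AM d' ∧ (∀ p q, d' p q ≤ d p q) ∧ ∀ z ∈ T, d' z.1 z.2 + d' z.1 (bar z.2) = 1 := by
    intro T
    induction T using Finset.induction_on with
    | empty => exact ⟨d, hd, fun _ _ => le_rfl, by simp⟩
    | insert z T _ ih =>
      obtain ⟨d1, am1, l1, t1⟩ := ih
      obtain ⟨d2, am2, l2, t2⟩ := am1.step z.1 z.2
      refine ⟨d2, am2, fun p q => (l2 p q).trans (l1 p q), ?_⟩
      intro y hy
      rcases Finset.mem_insert.1 hy with rfl | hy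
      · exact t2
      · apply le_antisymm
        · rw [← t1 y hy]
          exact add_le_add (l2 _ _) (l2 _ _)
        · have h1 := am2.tri y.2 y.1 (bar y.2)
          rwa [am2.opp, am2.sym y.2 y.1] at h1
  obtain ⟨d', h1, h2, h3⟩ := key Finset.univ
  exact ⟨d', h1, h2, fun p q => h3 (p, q) (Finset.mem_univ _)⟩

/-- bipartite double cover -/
def DC {V : Type} (G : SimpleGraph V) : SimpleGraph (V × Bool) where
  Adj p q := G.Adj p.1 q.1 ∧ p.2 ≠ q.2
  symm := ⟨fun _ _ h => ⟨h.1.symm, h.2.symm⟩⟩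
  loopless := ⟨fun _ h => h.2 rfl⟩

theorem DC_proj {V : Type} (G : SimpleGraph V) {p q : V × Bool} (W : (DC G).Walk p q) :
    ∃ W' : G.Walk p.1 q.1, W'.length = W.length ∧ (Odd W.length ↔ p.2 ≠ q.2) := by
  induction W with
  | nil => exact ⟨Walk.nil, rfl, by simp⟩
  | @cons p r q h W ih =>
    obtain ⟨W', h1, h2⟩ := ih
    refine ⟨Walk.cons h.1 W', by simp [h1], ?_⟩
    have h3 := h.2
    rw [Walk.length_cons, Nat.odd_add_one, h2]
    revert h3
    cases p.2 <;> cases r.2 <;> cases q.2 <;> simp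

theorem DC_bar {V : Type} (G : SimpleGraph V) {p q : V × Bool} (W : (DC G).Walk p q) :
    ∃ W' : (DC G).Walk (bar p) (bar q), W'.length = W.length := by
  induction W with
  | nil => exact ⟨Walk.nil, rfl⟩
  | @cons p r q h W ih =>
    obtain ⟨W', h1⟩ := ih
    have h' : (DC G).Adj (bar p) (bar r) := ⟨h.1, by simpa [bar] using h.2⟩
    exact ⟨Walk.cons h' W', by simp [h1]⟩

theorem exists_AM {V : Type} (G : SimpleGraph V) (g : ℕ) (hg0 : 1 ≤ g)
    (hg : ∀ (v : V) (c : G.Walk v v), c.IsCycle → Odd c.length → g ≤ c.length) :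
    ∃ d : V × Bool → V × Bool → ℝ, AM d ∧
      ∀ u v, G.Adj u v → d (u, false) (v, true) ≤ 1 / g := by
  have hgp : (0 : ℝ) < g := by exact_mod_cast hg0
  obtain ⟨d, hd⟩ : ∃ d : V × Bool → V × Bool → ℝ, ∀ p q, d p q =
    if (DC G).Reachable p q then min 1 (((DC G).dist p q : ℝ) / g) else 1 := ⟨_, fun _ _ => rfl⟩
  have l1 : ∀ p q, d p q ≤ 1 := by
    intro p q; rw [hd]; split_ifs <;> simp
  have lw : ∀ p q (W : (DC G).Walk p q), d p q ≤ W.length / g := by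
    intro p q W
    rw [hd, if_pos ⟨W⟩]
    refine (min_le_right _ _).trans ?_
    gcongr
    exact dist_le W
  have cs : ∀ p q, d p q = 1 ∨ ∃ W : (DC G).Walk p q, d p q = W.length / g := by
    intro p q
    by_cases h : (DC G).Reachable p q
    · obtain ⟨W, hW⟩ := h.exists_walk_length_eq_dist
      rcases min_choice (1 : ℝ) (((DC G).dist p q : ℝ) / g) with h' | h'
      · left; rw [hd, if_pos h, h']
      · right; exact ⟨W, by rw [hd, if_pos h, h', hW]⟩
    · left; rw [hd, if_neg h]
  have nn : ∀ p q, 0 ≤ d p q := by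
    intro p q
    rcases cs p q with h | ⟨W, h⟩ <;> rw [h] <;> positivity
  refine ⟨d, ⟨?_, ?_, ?_, l1, ?_, ?_⟩, ?_⟩
  · have : ∀ p q, d p q ≤ d q p := by
      intro p q
      rcases cs q p with h | ⟨W, h⟩ <;> rw [h]
      · exact l1 _ _
      · simpa using lw _ _ W.reverse
    exact fun p q => le_antisymm (this _ _) (this _ _)
  · intro p
    apply le_antisymm _ (nn _ _)
    simpa using lw p p Walk.nil
  · intro p q r
    rcases cs p q with h | ⟨W, h⟩
    · linarith [l1 p r, nn q r]
    · rcases cs q r with h' | ⟨W', h'⟩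
      · linarith [l1 p r, nn p q]
      · have := lw _ _ (W.append W')
        rw [Walk.length_append] at this
        push_cast at this
        rw [h, h', ← add_div]
        exact this
  · have : ∀ p q, d (bar p) (bar q) ≤ d p q := by
      intro p q
      rcases cs p q with h | ⟨W, h⟩ <;> rw [h]
      · exact l1 _ _
      · obtain ⟨W', h'⟩ := DC_bar G W
        rw [← h']
        exact lw _ _ W'
    intro p q
    apply le_antisymm (this p q)
    simpa using this (bar p) (bar q)
  · intro p
    apply le_antisymm (l1 _ _)
    rcases cs p (bar p) with h | ⟨W, h⟩ <;> rw [h]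
    obtain ⟨W', h1, h2⟩ := DC_proj G W
    have h3 : Odd W'.length := by rw [h1, h2]; simp [bar]
    have := oddwalk G g hg (u := p.1) W' h3
    replace this := this.trans_eq h1
    rw [le_div_iff₀ hgp, one_mul]
    exact_mod_cast this
  · intro u v huv
    have h' : (DC G).Adj (u, false) (v, true) := ⟨huv, by simp⟩
    have := lw (u, false) (v, true) (Walk.cons h' Walk.nil)
    rw [Walk.length_cons, Walk.length_nil] at this
    simpa using this

theorem exists_Met {V : Type} [Fintype V] (G : SimpleGraph V) (g : ℕ) (hg0 : 1 ≤ g)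
    (hg : ∀ (v : V) (c : G.Walk v v), c.IsCycle → Odd c.length → g ≤ c.length) :
    ∃ x : V → V → ℝ, Met x ∧ ∀ u v, G.Adj u v → 1 - 1 / (g : ℝ) ≤ x u v := by
  obtain ⟨d0, am0, h0⟩ := exists_AM G g hg0 hg
  obtain ⟨d, am, hle, hs⟩ := am0.full
  refine ⟨fun u v => d (u, false) (v, false), ⟨fun u v => am.sym _ _, fun u => am.self _,
    fun u v w => am.tri _ _ _, fun u v w => ?_⟩, fun u v huv => ?_⟩
  · have h1 := am.tri (u, false) (v, true) (w, false)
    have h2 := hs (u, false) (v, false)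
    have h3 := hs (v, true) (w, true)
    have h4 := am.anti (v, false) (w, false)
    simp only [bar, Bool.not_false, Bool.not_true] at h2 h3 h4
    linarith
  · have h1 := hle (u, false) (v, true)
    have h2 := h0 u v huv
    have h3 := hs (u, false) (v, false)
    simp only [bar, Bool.not_false] at h3
    linarith

theorem cut_bound {V : Type} [Fintype V] (G : SimpleGraph V) (hG : G.edgeSet.Nonempty)
    (c : ℝ) (x : V → V → ℝ) (hx : HasDist G x) (hc : ∀ u v, G.Adj u v → c ≤ x u v) :
    c ≤ sVal K2 G := by
  obtain ⟨Ω, _, μ, X, h0, h1, h2⟩ := hx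
  apply le_csInf
  · refine ⟨_, 2, ⊤, fun _ => 1, ⟨s(0, 1), by simp⟩, fun _ _ => by norm_num, rfl⟩
  · rintro _ ⟨n, H, w, hH, hw, rfl⟩
    have bdd : ∀ {β : Type} [Finite β] (N : SimpleGraph β),
        BddAbove (Set.range fun f : Fin n → β => cutWeight H N w f) :=
      fun N => (Set.finite_range _).bddAbove
    obtain ⟨e, he⟩ := hG
    induction e using Sym2.ind with | _ s t =>
    obtain ⟨e', he'⟩ := hH
    induction e' using Sym2.ind with | _ p q =>
    have hst : G.Adj s t := by simpa using he
    have hpq : H.Adj p q := by simpa using he'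
    have hpos : 0 < mcMax G H w := by
      refine lt_of_lt_of_le ?_ (le_ciSup (bdd G) (fun i => if i = p then s else t))
      have hwpos : (0 : ℝ) < w s(p, q) := by exact_mod_cast hw _ he'
      refine lt_of_lt_of_le hwpos ?_
      unfold cutWeight
      refine Finset.single_le_sum (f := fun e => (w e : ℝ)) ?_ ?_
      · intro e he
        have := hw e (Finset.mem_filter.1 he).2.1
        exact_mod_cast this.le
      · simp [hpq, hpq.ne', hst]
    rw [le_div_iff₀ hpos]
    have hne : Nonempty (Fin n → V) := ⟨fun _ => s⟩
    have key : ∀ f : Fin n → V, c * cutWeight H G w f ≤ mcMax K2 H w := by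
      intro f
      let E : Bool → Fin 2 := fun b => if b then 1 else 0
      have hE : ∀ a b, K2.Adj (E a) (E b) ↔ a ≠ b := by
        intro a b
        cases a <;> cases b <;> simp [K2, E]
      have hle : ∀ ω, cutWeight H K2 w (fun i => E (X ω (f i))) ≤ mcMax K2 H w :=
        fun ω => le_ciSup (bdd K2) _
      have hsum : ∑ ω, μ ω * cutWeight H K2 w (fun i => E (X ω (f i))) ≤ mcMax K2 H w := by
        calc _ ≤ ∑ ω, μ ω * mcMax K2 H w :=
              Finset.sum_le_sum fun ω _ => mul_le_mul_of_nonneg_left (hle ω) (h0 ω)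
          _ = _ := by rw [← Finset.sum_mul, h1, one_mul]
      refine le_trans ?_ hsum
      have hcw : ∀ ω, μ ω * cutWeight H K2 w (fun i => E (X ω (f i))) =
          ∑ e : Sym2 (Fin n), if e ∈ H.edgeSet then (w e : ℝ) *
            (if Sym2.map (fun i => E (X ω (f i))) e ∈ K2.edgeSet then μ ω else 0) else 0 := by
        intro ω
        unfold cutWeight
        rw [Finset.sum_filter, Finset.mul_sum]
        refine Finset.sum_congr rfl fun e _ => ?_
        by_cases k1 : e ∈ H.edgeSet <;>
          by_cases k2 : Sym2.map (fun i => E (X ω (f i))) e ∈ K2.edgeSet <;> simp [k1, k2, mul_comm]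
      simp only [hcw]
      rw [Finset.sum_comm]
      unfold cutWeight
      rw [Finset.sum_filter, Finset.mul_sum]
      refine Finset.sum_le_sum fun e _ => ?_
      by_cases k1 : e ∈ H.edgeSet
      swap
      · simp [k1]
      have hwe : (0 : ℝ) ≤ w e := by exact_mod_cast (hw e k1).le
      simp only [k1, true_and, if_true]
      rw [← Finset.mul_sum]
      by_cases k2 : Sym2.map f e ∈ G.edgeSet
      · rw [if_pos k2, mul_comm]
        refine mul_le_mul_of_nonneg_left ?_ hwe
        induction e using Sym2.ind with | _ i j =>
        have hij : G.Adj (f i) (f j) := by simpa using k2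
        refine (hc _ _ hij).trans (le_of_eq ?_)
        rw [← h2 _ _ hij]
        refine Finset.sum_congr rfl fun ω _ => ?_
        simp only [Sym2.map_mk, mem_edgeSet, hE]
      · rw [if_neg k2, mul_zero]
        refine mul_nonneg hwe (Finset.sum_nonneg fun ω _ => ?_)
        split_ifs
        · exact h0 ω
        · exact le_rfl
    by_cases hc0 : 0 ≤ c
    · unfold mcMax at *
      rw [Real.mul_iSup_of_nonneg hc0]
      exact ciSup_le key
    · have hz : 0 ≤ mcMax K2 H w := by
        refine le_trans ?_ (le_ciSup (bdd K2) (fun _ => 0))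
        refine Finset.sum_nonneg fun e he => ?_
        have := hw e (Finset.mem_filter.1 he).2.1
        exact_mod_cast this.le
      nlinarith

theorem main_bound {V : Type} [Fintype V] (G : SimpleGraph V) (hG : G.edgeSet.Nonempty)
    (hminor : ¬ HasMinor G (⊤ : SimpleGraph (Fin 4))) (g : ℕ) (hg0 : 1 ≤ g)
    (hg : ∀ (v : V) (c : G.Walk v v), c.IsCycle → Odd c.length → g ≤ c.length) :
    1 - 1 / (g : ℝ) ≤ sVal K2 G := by
  obtain ⟨x, hx, hxe⟩ := exists_Met G g hg0 hg
  exact cut_bound G hG _ x (hasDist_main _ V G x le_rfl hminor hx) hxe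

end S8

theorem stmt8 {V : Type} [Fintype V] (G : SimpleGraph V) (hG : G.edgeSet.Nonempty)
    (hminor : ¬ HasMinor G (⊤ : SimpleGraph (Fin 4))) (k : ℕ) (hk : 1 ≤ k) :
    ((∀ (v : V) (c : G.Walk v v), c.IsCycle → Odd c.length → 6*k-1 ≤ c.length) →
      sVal K2 G ≥ (4*(k:ℝ)) / (4*(k:ℝ)+1)) ∧
    ((∀ (v : V) (c : G.Walk v v), c.IsCycle → Odd c.length → 6*k+3 ≤ c.length) →
      sVal K2 G ≥ (4*(k:ℝ)+2) / (4*(k:ℝ)+3)) := by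
  have hk' : (1 : ℝ) ≤ k := by exact_mod_cast hk
  constructor
  · intro h
    refine ge_trans (S8.main_bound G hG hminor (6*k-1) (by omega) h) ?_
    rw [Nat.cast_sub (by omega)]
    push_cast
    have h1 : 4 * (k:ℝ) / (4 * (k:ℝ) + 1) = 1 - 1 / (4 * (k:ℝ) + 1) := by field_simp; ring
    rw [h1]
    have : 1 / (6 * (k:ℝ) - 1) ≤ 1 / (4 * (k:ℝ) + 1) :=
      one_div_le_one_div_of_le (by linarith) (by linarith)
    linarith
  · intro h
    refine ge_trans (S8.main_bound G hG hminor (6*k+3) (by omega) h) ?_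
    push_cast
    have h1 : (4 * (k:ℝ) + 2) / (4 * (k:ℝ) + 3) = 1 - 1 / (4 * (k:ℝ) + 3) := by field_simp; ring
    rw [h1]
    have : 1 / (6 * (k:ℝ) + 3) ≤ 1 / (4 * (k:ℝ) + 3) :=
      one_div_le_one_div_of_le (by linarith) (by linarith)
    linarith
end
end

section
/- For finite simple graphs G and H, each with at least one edge, χ_H(G) = inf { n/k : G admits a homomorphism to H^n_k }, where n and k range over positive integers. -/
open scoped Classical

noncomputable section

/-- An `H`-cut in `G`: the set of edges of `G` carried to edges of `H` by some vertex map. -/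
def IsHCut {V W : Type} (G : SimpleGraph V) (H : SimpleGraph W) (X : Set (Sym2 V)) : Prop :=
  ∃ f : V → W, X = {e ∈ G.edgeSet | Sym2.map f e ∈ H.edgeSet}

/-- `χ_H(G)`: the infimum of `n/k` over all `H`-cut `n/k`-covers of `G`, i.e. collections
`X_1, …, X_n` of `H`-cuts in `G` such that every edge of `G` lies in at least `k` of them. -/
def chiH {V W : Type} (H : SimpleGraph W) (G : SimpleGraph V) : ℝ :=
  sInf { x : ℝ | ∃ (n k : ℕ) (X : Fin n → Set (Sym2 V)), 0 < k ∧
    (∀ i, IsHCut G H (X i)) ∧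
    (∀ e ∈ G.edgeSet, k ≤ (Finset.univ.filter (fun i => e ∈ X i)).card) ∧
    x = (n : ℝ) / (k : ℝ) }

/-- The graph `H^n_k` on vertex set `V(H)^n`, with `u` adjacent to `v` exactly when
`u_i v_i` is an edge of `H` for at least `k` coordinates `i`. -/
def powGraph {W : Type} (H : SimpleGraph W) (n k : ℕ) : SimpleGraph (Fin n → W) :=
  SimpleGraph.fromRel (fun u v => k ≤ (Finset.univ.filter (fun i => H.Adj (u i) (v i))).card)

theorem stmt10 {V W : Type} [Fintype V] [Fintype W] (G : SimpleGraph V) (H : SimpleGraph W)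
    (hG : G.edgeSet.Nonempty) (hH : H.edgeSet.Nonempty) :
    chiH H G = sInf { x : ℝ | ∃ n k : ℕ, 0 < n ∧ 0 < k ∧
      Nonempty (G →g powGraph H n k) ∧ x = (n : ℝ) / (k : ℝ) } := by
  unfold chiH
  congr 1
  ext x
  constructor
  · rintro ⟨n, k, X, hk, hX, hcov, rfl⟩
    choose f hf using hX
    have key : ∀ a b, G.Adj a b →
        k ≤ (Finset.univ.filter (fun i => H.Adj (f i a) (f i b))).card := by
      intro a b hab
      refine (hcov s(a, b) hab).trans (Finset.card_le_card ?_)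
      intro i hi
      have h2 := (Finset.mem_filter.mp hi).2
      rw [hf i] at h2
      exact Finset.mem_filter.mpr ⟨Finset.mem_univ _, h2.2⟩
    refine ⟨n, k, ?_, hk, ⟨⟨fun v i => f i v, ?_⟩⟩, rfl⟩
    · obtain ⟨e, he⟩ := hG
      have h1 := (hcov e he).trans (Finset.card_le_univ _)
      rw [Fintype.card_fin] at h1
      omega
    · intro a b hab
      have h1 := key a b hab
      refine (SimpleGraph.fromRel_adj _ _ _).mpr ⟨?_, Or.inl h1⟩
      intro heq
      obtain ⟨i, hi⟩ := Finset.card_pos.mp (lt_of_lt_of_le hk h1)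
      have h2 := (Finset.mem_filter.mp hi).2
      have h3 : f i a = f i b := congrFun heq i
      exact h2.ne h3
  · rintro ⟨n, k, hn, hk, ⟨φ⟩, rfl⟩
    refine ⟨n, k, fun i => {e ∈ G.edgeSet | Sym2.map (fun v => φ v i) e ∈ H.edgeSet}, hk,
      fun i => ⟨fun v => φ v i, rfl⟩, ?_, rfl⟩
    intro e
    induction e using Sym2.ind with
    | _ a b =>
      intro hab
      rcases ((SimpleGraph.fromRel_adj _ _ _).mp (φ.map_adj hab)).2 with h | h
      · refine h.trans (Finset.card_le_card ?_)
        intro i hi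
        have h2 := (Finset.mem_filter.mp hi).2
        refine (@Finset.mem_filter _ _ (_) _ _).mpr ?_
        exact ⟨Finset.mem_univ _, hab, h2⟩
      · refine h.trans (Finset.card_le_card ?_)
        intro i hi
        have h2 := (Finset.mem_filter.mp hi).2
        refine (@Finset.mem_filter _ _ (_) _ _).mpr ?_
        exact ⟨Finset.mem_univ _, hab, h2.symm⟩
end
end
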